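/- Suppose the likelihood potentials Φ and Φ' both satisfy Assumption A with the same functions (f,g,h), and let p,q ∈ [1,∞] satisfy 1/p + 1/q = 1. Let ν and ν' be the posteriors obtained from the prior μ with potentials Φ and Φ' respectively, at data y ∈ Y, with normalizing constants Z(y) and Z'(y). Then D(ν,ν';c) ≤ ( g(y) ‖f·c(·,0)‖_{L^p(μ)} [ Z(y) + g(y) ‖f‖_{L^p(μ)} ] / ( Z(y) Z'(y) ) ) · ‖Φ(·;y) − Φ'(·;y)‖_{L^q(μ)}. -/

import Mathlib

open MeasureTheory Real ENNReal

/-- The integral probability metric `D(η₁, η₂; c)`: supremum of `∫ψ dη₁ − ∫ψ dη₂` over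
functions `ψ` vanishing at the origin that are Lipschitz-1 with respect to the
distance-like function `c`. -/
noncomputable def ipm {X : Type*} [MeasurableSpace X] [Zero X]
    (c : X → X → ℝ) (η₁ η₂ : Measure X) : ℝ :=
  sSup {r : ℝ | ∃ ψ : X → ℝ, ψ 0 = 0 ∧ (∀ u v, |ψ u - ψ v| ≤ c u v) ∧
    r = (∫ u, ψ u ∂η₁) - ∫ u, ψ u ∂η₂}

/-- The optimal transport cost `W(η₁, η₂; c)`: infimum of `∫ c dπ` over couplings `π`
of `(η₁, η₂)`. -/
noncomputable def otCost {X : Type*} [MeasurableSpace X]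
    (c : X → X → ℝ) (η₁ η₂ : Measure X) : ℝ≥0∞ :=
  ⨅ pl ∈ {pl : Measure (X × X) |
      pl.map Prod.fst = η₁ ∧ pl.map Prod.snd = η₂ ∧ IsProbabilityMeasure pl},
    ∫⁻ p, ENNReal.ofReal (c p.1 p.2) ∂pl

/-- `c : X × X → ℝ` is distance-like: nonnegative, symmetric, lower semicontinuous and
vanishing exactly on the diagonal. -/
def DistanceLike {X : Type*} [TopologicalSpace X] (c : X → X → ℝ) : Prop :=
  (∀ u v, 0 ≤ c u v) ∧ (∀ u v, c u v = c v u) ∧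
    LowerSemicontinuous (fun p : X × X => c p.1 p.2) ∧
    ∀ u v, c u v = 0 ↔ u = v

/-- The posterior measure with prior `μ` and likelihood potential `Φ`:
`dν/dμ (u) = exp (−Φ u) / Z` with `Z = ∫ exp (−Φ u) dμ(u)`. -/
noncomputable def post {X : Type*} [MeasurableSpace X]
    (μ : Measure X) (Φ : X → ℝ) : Measure X :=
  μ.withDensity fun u => ENNReal.ofReal (Real.exp (-Φ u) / ∫ v, Real.exp (-Φ v) ∂μ)

/-- Assumption A on a likelihood potential `Φ : X × Y → ℝ` with functions `(f, g, h)`: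
(i) `Φ(·; y)` is `μ`-measurable for every `y`; (ii) `f : X → (0,∞)` is lower
semicontinuous, `g : Y → (0,∞)` and `h : X × Y → (0,∞)` are locally bounded, and
`−log f(u) − log g(y) ≤ Φ(u; y) ≤ −log h(u, y)` for all `(u, y)`. -/
structure AssumptionA {X Y : Type*} [MeasurableSpace X] [TopologicalSpace X]
    [TopologicalSpace Y] (μ : Measure X) (Φ : X → Y → ℝ)
    (f : X → ℝ) (g : Y → ℝ) (h : X → Y → ℝ) : Prop where
  measurable : ∀ y, AEMeasurable (fun u => Φ u y) μ
  f_pos : ∀ u, 0 < f u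
  f_lsc : LowerSemicontinuous f
  g_pos : ∀ y, 0 < g y
  g_locBdd : ∀ y : Y, ∃ s ∈ nhds y, BddAbove (g '' s)
  h_pos : ∀ u y, 0 < h u y
  h_locBdd : ∀ p : X × Y, ∃ s ∈ nhds p, BddAbove ((fun q : X × Y => h q.1 q.2) '' s)
  lower_bound : ∀ u y, -Real.log (f u) - Real.log (g y) ≤ Φ u y
  upper_bound : ∀ u y, Φ u y ≤ -Real.log (h u y)

/-- The exponential is Lipschitz with constant `M` where it is bounded by `M`. -/
lemma abs_exp_sub_exp_le_mul {a b M : ℝ} (ha : Real.exp a ≤ M) (hb : Real.exp b ≤ M) :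
    |Real.exp a - Real.exp b| ≤ M * |a - b| := by
  have one_side : ∀ {s t : ℝ}, s ≤ t → Real.exp t ≤ M → Real.exp t - Real.exp s ≤ M * (t - s) := by
    intro s t hst hM
    have h1 : Real.exp s = Real.exp t * Real.exp (s - t) := by
      rw [← Real.exp_add]; ring_nf
    have h2 : s - t + 1 ≤ Real.exp (s - t) := Real.add_one_le_exp _
    nlinarith [Real.exp_pos t, mul_le_mul_of_nonneg_left h2 (Real.exp_pos t).le,
      mul_le_mul_of_nonneg_right hM (sub_nonneg.2 hst)]
  rcases le_total a b with hab | hab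
  · rw [abs_sub_comm, abs_sub_comm a, abs_of_nonneg (sub_nonneg.2 (Real.exp_le_exp.2 hab)),
      abs_of_nonneg (sub_nonneg.2 hab)]
    exact one_side hab hb
  · rw [abs_of_nonneg (sub_nonneg.2 (Real.exp_le_exp.2 hab)), abs_of_nonneg (sub_nonneg.2 hab)]
    exact one_side hab ha

/-- Hölder's inequality for the Lebesgue integral of a product. -/
lemma lintegral_enorm_mul_le_eLpNorm_mul_eLpNorm {α : Type*} [MeasurableSpace α] {μ : Measure α}
    {p q : ℝ≥0∞} (hpq : 1 / p + 1 / q = 1) {F G : α → ℝ}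
    (hF : AEStronglyMeasurable F μ) (hG : AEStronglyMeasurable G μ) :
    ∫⁻ u, ‖F u * G u‖ₑ ∂μ ≤ eLpNorm F p μ * eLpNorm G q μ := by
  have : HolderTriple p q 1 := ⟨by simpa [one_div] using hpq⟩
  simpa [eLpNorm_one_eq_lintegral_enorm] using
    eLpNorm_smul_le_mul_eLpNorm (p := p) (q := q) (r := 1) hG hF

/-- On a probability space the `L¹` norm is at most the `Lᵖ` norm. -/
lemma lintegral_enorm_le_eLpNorm {α : Type*} [MeasurableSpace α] {μ : Measure α}
    [IsProbabilityMeasure μ] {p : ℝ≥0∞} (hp : 1 ≤ p) {F : α → ℝ}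
    (hF : AEStronglyMeasurable F μ) :
    ∫⁻ u, ‖F u‖ₑ ∂μ ≤ eLpNorm F p μ := by
  rw [← eLpNorm_one_eq_lintegral_enorm]
  exact eLpNorm_le_eLpNorm_of_exponent_le hp hF

lemma AssumptionA.exp_neg_le {X Y : Type*} [MeasurableSpace X] [TopologicalSpace X]
    [TopologicalSpace Y] {μ : Measure X} {Φ : X → Y → ℝ} {f : X → ℝ} {g : Y → ℝ}
    {h : X → Y → ℝ} (hA : AssumptionA μ Φ f g h) (u : X) (y : Y) :
    Real.exp (-Φ u y) ≤ f u * g y := by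
  rw [← Real.exp_log (mul_pos (hA.f_pos u) (hA.g_pos y)),
    Real.log_mul (hA.f_pos u).ne' (hA.g_pos y).ne']
  exact Real.exp_le_exp.2 (by linarith [hA.lower_bound u y])

lemma integral_post {X : Type*} [MeasurableSpace X] {μ : Measure X} {Φ : X → ℝ}
    (hΦ : AEMeasurable Φ μ) (ψ : X → ℝ) :
    ∫ u, ψ u ∂(post μ Φ) =
      ∫ u, Real.exp (-Φ u) / (∫ v, Real.exp (-Φ v) ∂μ) * ψ u ∂μ := by
  have hZ : 0 ≤ ∫ v, Real.exp (-Φ v) ∂μ := integral_nonneg fun _ => (Real.exp_pos _).le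
  have hm : AEMeasurable
      (fun u => (Real.exp (-Φ u) / ∫ v, Real.exp (-Φ v) ∂μ).toNNReal) μ :=
    ((Real.measurable_exp.comp_aemeasurable hΦ.neg).div_const _).real_toNNReal
  refine (integral_withDensity_eq_integral_smul₀ hm ψ).trans (integral_congr_ae ?_)
  refine Filter.Eventually.of_forall fun u => ?_
  simp only [NNReal.smul_def, smul_eq_mul,
    Real.coe_toNNReal _ (div_nonneg (Real.exp_pos _).le hZ)]

/-- Pointwise estimate for the difference of two normalized densities. -/
lemma abs_div_sub_div_le {a b M δ Z Z' : ℝ} (ha : 0 ≤ a) (haM : a ≤ M)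
    (hab : |a - b| ≤ M * δ) (hZ : 0 < Z) (hZ' : 0 < Z') :
    |a / Z - b / Z'| ≤ M * δ / Z' + M * (|Z - Z'| / (Z * Z')) := by
  have hsplit : a / Z - b / Z' = (a - b) / Z' + a * ((Z' - Z) / (Z * Z')) := by
    field_simp
    ring
  rw [hsplit]
  refine (abs_add_le _ _).trans (add_le_add ?_ ?_)
  · rw [abs_div, abs_of_pos hZ']
    gcongr
  · rw [abs_mul, abs_of_nonneg ha, abs_div, abs_of_pos (mul_pos hZ hZ'), abs_sub_comm]
    gcongr

/-- Stability of expectations under posteriors whose unnormalized densities are dominated by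
`F`, for test functions dominated by `C`. -/
lemma ofReal_integral_post_sub_le {X : Type*} [MeasurableSpace X] {μ : Measure X}
    [IsProbabilityMeasure μ] {Φ Φ' F C ψ : X → ℝ} {γ : ℝ} {p q : ℝ≥0∞}
    (hp : 1 ≤ p) (hpq : 1 / p + 1 / q = 1) (hγ : 0 < γ)
    (hΦ : AEMeasurable Φ μ) (hΦ' : AEMeasurable Φ' μ)
    (hF : MemLp F p μ) (hFC : MemLp (fun u => F u * C u) p μ)
    (hΦF : ∀ u, Real.exp (-Φ u) ≤ F u * γ) (hΦF' : ∀ u, Real.exp (-Φ' u) ≤ F u * γ)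
    (hψC : ∀ u, |ψ u| ≤ C u) :
    ENNReal.ofReal ((∫ u, ψ u ∂(post μ Φ)) - ∫ u, ψ u ∂(post μ Φ')) ≤
      ENNReal.ofReal γ * eLpNorm (fun u => F u * C u) p μ *
        (ENNReal.ofReal (∫ u, Real.exp (-Φ u) ∂μ) + ENNReal.ofReal γ * eLpNorm F p μ) /
        (ENNReal.ofReal (∫ u, Real.exp (-Φ u) ∂μ) *
          ENNReal.ofReal (∫ u, Real.exp (-Φ' u) ∂μ)) *
        eLpNorm (fun u => Φ u - Φ' u) q μ := by
  have hF1 : Integrable F μ := hF.integrable hp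
  have hFC1 : Integrable (fun u => F u * C u) μ := hFC.integrable hp
  have exp_aesm : ∀ {Θ : X → ℝ}, AEMeasurable Θ μ →
      AEStronglyMeasurable (fun u => Real.exp (-Θ u)) μ := fun hΘ =>
    (Real.measurable_exp.comp_aemeasurable hΘ.neg).aestronglyMeasurable
  have exp_int : ∀ {Θ : X → ℝ}, AEMeasurable Θ μ → (∀ u, Real.exp (-Θ u) ≤ F u * γ) →
      Integrable (fun u => Real.exp (-Θ u)) μ := fun hΘ hle =>
    (hF1.mul_const γ).mono' (exp_aesm hΘ) (Filter.Eventually.of_forall fun u => by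
      rw [Real.norm_of_nonneg (Real.exp_pos _).le]; exact hle u)
  have hE := exp_int hΦ hΦF
  have hE' := exp_int hΦ' hΦF'
  have hZ : 0 < ∫ u, Real.exp (-Φ u) ∂μ := integral_exp_pos hE
  have hZ' : 0 < ∫ u, Real.exp (-Φ' u) ∂μ := integral_exp_pos hE'
  rw [integral_post hΦ, integral_post hΦ']
  set Z := ∫ u, Real.exp (-Φ u) ∂μ with hZdef
  set Z' := ∫ u, Real.exp (-Φ' u) ∂μ with hZdef'
  by_cases hψ : AEStronglyMeasurable ψ μ
  swap
  · have zero : ∀ {Θ : X → ℝ} {W : ℝ}, AEMeasurable Θ μ → 0 < W →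
        ∫ u, Real.exp (-Θ u) / W * ψ u ∂μ = 0 := by
      intro Θ W hΘ hW
      refine integral_undef fun hint => hψ ?_
      have hinv : AEStronglyMeasurable (fun u => (Real.exp (-Θ u) / W)⁻¹) μ :=
        ((exp_aesm hΘ).aemeasurable.div_const W).inv.aestronglyMeasurable
      refine (hinv.mul hint.aestronglyMeasurable).congr (Filter.Eventually.of_forall fun u => ?_)
      have : Real.exp (-Θ u) / W ≠ 0 := (div_pos (Real.exp_pos _) hW).ne'
      simp only [Pi.mul_apply]
      exact inv_mul_cancel_left₀ this _
    rw [zero hΦ hZ, zero hΦ' hZ']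
    simp
  have dens_int : ∀ {Θ : X → ℝ} {W : ℝ}, AEMeasurable Θ μ →
      (∀ u, Real.exp (-Θ u) ≤ F u * γ) → 0 < W →
      Integrable (fun u => Real.exp (-Θ u) / W * ψ u) μ := by
    intro Θ W hΘ hle hW
    refine (hFC1.mul_const (γ / W)).mono'
      (((exp_aesm hΘ).aemeasurable.div_const W).aestronglyMeasurable.mul hψ)
      (Filter.Eventually.of_forall fun u => ?_)
    rw [norm_mul, Real.norm_of_nonneg (div_pos (Real.exp_pos _) hW).le, Real.norm_eq_abs]
    calc Real.exp (-Θ u) / W * |ψ u| ≤ F u * γ / W * C u :=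
          mul_le_mul (by gcongr; exact hle u) (hψC u) (abs_nonneg _)
            (div_nonneg ((Real.exp_pos _).le.trans (hle u)) hW.le)
      _ = F u * C u * (γ / W) := by ring
  rw [← integral_sub (dens_int hΦ hΦF hZ) (dens_int hΦ' hΦF' hZ')]
  have hF0 : ∀ u, 0 ≤ F u := fun u =>
    nonneg_of_mul_nonneg_left ((Real.exp_pos _).le.trans (hΦF u)) hγ
  have hC0 : ∀ u, 0 ≤ C u := fun u => (abs_nonneg _).trans (hψC u)
  have hexp : ∀ u, |Real.exp (-Φ u) - Real.exp (-Φ' u)| ≤ F u * γ * |Φ u - Φ' u| := by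
    intro u
    have := abs_exp_sub_exp_le_mul (hΦF u) (hΦF' u)
    rwa [neg_sub_neg, abs_sub_comm (Φ' u)] at this
  have hΔ : AEStronglyMeasurable (fun u => Φ u - Φ' u) μ := (hΦ.sub hΦ').aestronglyMeasurable
  have hZZ : ENNReal.ofReal |Z - Z'| ≤
      ENNReal.ofReal γ * (eLpNorm F p μ * eLpNorm (fun u => Φ u - Φ' u) q μ) := by
    rw [hZdef, hZdef', ← integral_sub hE hE', ← Real.enorm_eq_ofReal_abs]
    calc ‖∫ u, (Real.exp (-Φ u) - Real.exp (-Φ' u)) ∂μ‖ₑ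
        ≤ ∫⁻ u, ‖Real.exp (-Φ u) - Real.exp (-Φ' u)‖ₑ ∂μ := enorm_integral_le_lintegral_enorm _
      _ ≤ ∫⁻ u, ENNReal.ofReal γ * ‖F u * (Φ u - Φ' u)‖ₑ ∂μ := by
          refine lintegral_mono fun u => ?_
          rw [Real.enorm_eq_ofReal_abs, Real.enorm_eq_ofReal_abs, ← ENNReal.ofReal_mul hγ.le,
            abs_mul, abs_of_nonneg (hF0 u)]
          exact ENNReal.ofReal_le_ofReal ((hexp u).trans_eq (by ring))
      _ ≤ _ := by
          rw [lintegral_const_mul' _ _ ENNReal.ofReal_ne_top]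
          gcongr
          exact lintegral_enorm_mul_le_eLpNorm_mul_eLpNorm hpq hF.1 hΔ
  have hpt : ∀ u, ‖Real.exp (-Φ u) / Z * ψ u - Real.exp (-Φ' u) / Z' * ψ u‖ₑ ≤
      ENNReal.ofReal (γ / Z') * ‖F u * C u * (Φ u - Φ' u)‖ₑ +
        ENNReal.ofReal (γ * (|Z - Z'| / (Z * Z'))) * ‖F u * C u‖ₑ := by
    intro u
    simp only [Real.enorm_eq_ofReal_abs]
    rw [← ENNReal.ofReal_mul (by positivity), ← ENNReal.ofReal_mul (by positivity),
      ← ENNReal.ofReal_add (by positivity) (by positivity)]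
    refine ENNReal.ofReal_le_ofReal ?_
    rw [← sub_mul, abs_mul, abs_mul (F u * C u), abs_of_nonneg (mul_nonneg (hF0 u) (hC0 u))]
    have hd := abs_div_sub_div_le (Real.exp_pos _).le (hΦF u) (hexp u) hZ hZ'
    calc _ ≤ _ := mul_le_mul hd (hψC u) (abs_nonneg _) ((abs_nonneg _).trans hd)
      _ = _ := by ring
  set N := eLpNorm (fun u => F u * C u) p μ
  set K := eLpNorm F p μ
  set D := eLpNorm (fun u => Φ u - Φ' u) q μ
  have hZ0 : ENNReal.ofReal Z ≠ 0 := by simpa using hZ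
  have hZ0' : ENNReal.ofReal Z' ≠ 0 := by simpa using hZ'
  calc ENNReal.ofReal (∫ u, (Real.exp (-Φ u) / Z * ψ u - Real.exp (-Φ' u) / Z' * ψ u) ∂μ)
      ≤ ‖∫ u, (Real.exp (-Φ u) / Z * ψ u - Real.exp (-Φ' u) / Z' * ψ u) ∂μ‖ₑ := by
        rw [Real.enorm_eq_ofReal_abs]
        exact ENNReal.ofReal_le_ofReal (le_abs_self _)
    _ ≤ ∫⁻ u, ‖Real.exp (-Φ u) / Z * ψ u - Real.exp (-Φ' u) / Z' * ψ u‖ₑ ∂μ :=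
        enorm_integral_le_lintegral_enorm _
    _ ≤ ∫⁻ u, (ENNReal.ofReal (γ / Z') * ‖F u * C u * (Φ u - Φ' u)‖ₑ +
          ENNReal.ofReal (γ * (|Z - Z'| / (Z * Z'))) * ‖F u * C u‖ₑ) ∂μ := lintegral_mono hpt
    _ = ENNReal.ofReal (γ / Z') * ∫⁻ u, ‖F u * C u * (Φ u - Φ' u)‖ₑ ∂μ +
          ENNReal.ofReal (γ * (|Z - Z'| / (Z * Z'))) * ∫⁻ u, ‖F u * C u‖ₑ ∂μ := by
        rw [lintegral_add_right' _ (hFC.1.enorm.const_mul _),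
          lintegral_const_mul' _ _ ENNReal.ofReal_ne_top,
          lintegral_const_mul' _ _ ENNReal.ofReal_ne_top]
    _ ≤ ENNReal.ofReal (γ / Z') * (N * D) + ENNReal.ofReal (γ * (|Z - Z'| / (Z * Z'))) * N := by
        gcongr
        · exact lintegral_enorm_mul_le_eLpNorm_mul_eLpNorm hpq hFC.1 hΔ
        · exact lintegral_enorm_le_eLpNorm hp hFC.1
    _ ≤ ENNReal.ofReal γ / ENNReal.ofReal Z' * (N * D) +
          ENNReal.ofReal γ * (ENNReal.ofReal γ * (K * D) /
            (ENNReal.ofReal Z * ENNReal.ofReal Z')) * N := by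
        rw [ENNReal.ofReal_div_of_pos hZ', ENNReal.ofReal_mul hγ.le,
          ENNReal.ofReal_div_of_pos (mul_pos hZ hZ'), ENNReal.ofReal_mul hZ.le]
        gcongr
    _ = _ := by
        have hone : ENNReal.ofReal γ / ENNReal.ofReal Z' = ENNReal.ofReal γ * ENNReal.ofReal Z /
            (ENNReal.ofReal Z * ENNReal.ofReal Z') := by
          rw [mul_comm (ENNReal.ofReal Z),
            ENNReal.mul_div_mul_right _ _ hZ0 ENNReal.ofReal_ne_top]
        rw [hone]
        simp only [div_eq_mul_inv]
        ring

/-- Almost everywhere equal potentials have the same posterior. -/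
lemma post_congr_ae {X : Type*} [MeasurableSpace X] {μ : Measure X} {Φ Φ' : X → ℝ}
    (hΦ : Φ =ᵐ[μ] Φ') : post μ Φ = post μ Φ' := by
  have hexp : (fun u => Real.exp (-Φ u)) =ᵐ[μ] fun u => Real.exp (-Φ' u) := by
    filter_upwards [hΦ] with u hu
    rw [hu]
  unfold post
  rw [integral_congr_ae hexp]
  refine withDensity_congr_ae ?_
  filter_upwards [hΦ] with u hu
  rw [hu]

lemma LowerSemicontinuous.comp_prodMk_right {X : Type*} [TopologicalSpace X] {c : X → X → ℝ}
    (hc : LowerSemicontinuous fun p : X × X => c p.1 p.2) (v : X) :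
    LowerSemicontinuous fun u => c u v :=
  LowerSemicontinuous.comp hc (g := fun u : X => (u, v)) (by fun_prop)

/-- Explicit likelihood perturbation bound in terms of the normalizing
constants `Z(y)` and `Z'(y)`:
`D(ν,ν';c) ≤ g(y) ‖f·c(·,0)‖_{Lᵖ(μ)} [Z(y) + g(y)‖f‖_{Lᵖ(μ)}] / (Z(y) Z'(y)) ·
‖Φ(·;y) − Φ'(·;y)‖_{L^q(μ)}`. -/
theorem posterior_likelihood_perturbation_explicit
    {X Y : Type*} [NormedAddCommGroup X] [NormedSpace ℝ X] [CompleteSpace X]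
    [SecondCountableTopology X] [MeasurableSpace X] [BorelSpace X]
    [NormedAddCommGroup Y] [NormedSpace ℝ Y] [CompleteSpace Y] [SecondCountableTopology Y]
    (μ : Measure X) [IsProbabilityMeasure μ]
    (c : X → X → ℝ) (hc : DistanceLike c)
    (Φ Φ' : X → Y → ℝ) (f : X → ℝ) (g : Y → ℝ) (h : X → Y → ℝ)
    (hA : AssumptionA μ Φ f g h) (hA' : AssumptionA μ Φ' f g h)
    (p q : ℝ≥0∞) (hp : 1 ≤ p) (hq : 1 ≤ q) (hpq : 1 / p + 1 / q = 1)
    (y : Y) :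
    ENNReal.ofReal (ipm c (post μ fun u => Φ u y) (post μ fun u => Φ' u y)) ≤
      ENNReal.ofReal (g y) * eLpNorm (fun u => f u * c u 0) p μ *
        (ENNReal.ofReal (∫ u, Real.exp (-Φ u y) ∂μ) +
          ENNReal.ofReal (g y) * eLpNorm f p μ) /
        (ENNReal.ofReal (∫ u, Real.exp (-Φ u y) ∂μ) *
          ENNReal.ofReal (∫ u, Real.exp (-Φ' u y) ∂μ)) *
        eLpNorm (fun u => Φ u y - Φ' u y) q μ := by
  set B := ENNReal.ofReal (g y) * eLpNorm (fun u => f u * c u 0) p μ *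
        (ENNReal.ofReal (∫ u, Real.exp (-Φ u y) ∂μ) +
          ENNReal.ofReal (g y) * eLpNorm f p μ) /
        (ENNReal.ofReal (∫ u, Real.exp (-Φ u y) ∂μ) *
          ENNReal.ofReal (∫ u, Real.exp (-Φ' u y) ∂μ)) *
        eLpNorm (fun u => Φ u y - Φ' u y) q μ with hB
  suffices key : ∀ ψ : X → ℝ, ψ 0 = 0 → (∀ u v, |ψ u - ψ v| ≤ c u v) →
      ENNReal.ofReal ((∫ u, ψ u ∂(post μ fun u => Φ u y)) -
        ∫ u, ψ u ∂(post μ fun u => Φ' u y)) ≤ B by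
    rcases eq_or_ne B ⊤ with hT | hT
    · rw [hT]; exact le_top
    refine ENNReal.ofReal_le_of_le_toReal (Real.sSup_le ?_ ENNReal.toReal_nonneg)
    rintro r ⟨ψ, hψ0, hψ, rfl⟩
    exact (ENNReal.ofReal_le_iff_le_toReal hT).1 (key ψ hψ0 hψ)
  intro ψ hψ0 hψ
  have hψc : ∀ u, |ψ u| ≤ c u 0 := fun u => by simpa [hψ0] using hψ u 0
  have hf : AEStronglyMeasurable f μ := hA.f_lsc.measurable.aestronglyMeasurable
  have hfc : AEStronglyMeasurable (fun u => f u * c u 0) μ :=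
    hf.mul (LowerSemicontinuous.comp_prodMk_right hc.2.2.1 0).measurable.aestronglyMeasurable
  have hΔ : AEStronglyMeasurable (fun u => Φ u y - Φ' u y) μ :=
    ((hA.measurable y).sub (hA'.measurable y)).aestronglyMeasurable
  have hp0 : p ≠ 0 := (one_pos.trans_le hp).ne'
  have hq0 : q ≠ 0 := (one_pos.trans_le hq).ne'
  by_cases hD : eLpNorm (fun u => Φ u y - Φ' u y) q μ = 0
  · have heq : (fun u => Φ u y) =ᵐ[μ] fun u => Φ' u y := by
      filter_upwards [(eLpNorm_eq_zero_iff hΔ hq0).1 hD] with u hu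
      exact sub_eq_zero.1 hu
    rw [post_congr_ae heq]
    simp
  by_cases hN : eLpNorm (fun u => f u * c u 0) p μ = 0
  · have hψae : ψ =ᵐ[μ] 0 := by
      filter_upwards [(eLpNorm_eq_zero_iff hfc hp0).1 hN] with u hu
      have hcu : c u 0 = 0 := (mul_eq_zero.1 hu).resolve_left (hA.f_pos u).ne'
      exact abs_nonpos_iff.1 (hcu ▸ hψc u)
    have zero : ∀ Θ : X → ℝ, ∫ u, ψ u ∂(post μ Θ) = 0 := fun Θ =>
      integral_eq_zero_of_ae ((withDensity_absolutelyContinuous μ _).ae_le hψae)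
    rw [zero, zero]
    simp
  have hK : eLpNorm f p μ ≠ 0 := fun hzero => by
    obtain ⟨u, hu⟩ := ((eLpNorm_eq_zero_iff hf hp0).1 hzero).exists
    exact (hA.f_pos u).ne' hu
  have hG : ENNReal.ofReal (g y) ≠ 0 := by simpa using hA.g_pos y
  by_cases hfin : eLpNorm f p μ ≠ ⊤ ∧ eLpNorm (fun u => f u * c u 0) p μ ≠ ⊤
  · exact ofReal_integral_post_sub_le hp hpq (hA.g_pos y) (hA.measurable y) (hA'.measurable y)
      ⟨hf, hfin.1.lt_top⟩ ⟨hfc, hfin.2.lt_top⟩ (fun u => hA.exp_neg_le u y)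
      (fun u => hA'.exp_neg_le u y) hψc
  · have hnum : ENNReal.ofReal (g y) * eLpNorm (fun u => f u * c u 0) p μ *
        (ENNReal.ofReal (∫ u, Real.exp (-Φ u y) ∂μ) +
          ENNReal.ofReal (g y) * eLpNorm f p μ) = ⊤ := by
      rw [not_and_or, not_not, not_not] at hfin
      rcases hfin with hT | hT
      · rw [hT, ENNReal.mul_top hG, add_top, ENNReal.mul_top (mul_ne_zero hG hN)]
      · rw [hT, ENNReal.mul_top hG, ENNReal.top_mul]
        exact fun hzero => mul_ne_zero hG hK (add_eq_zero.1 hzero).2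
    rw [hB, hnum, ENNReal.top_div_of_ne_top
      (ENNReal.mul_ne_top ENNReal.ofReal_ne_top ENNReal.ofReal_ne_top), ENNReal.top_mul hD]
    exact le_top
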